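/- arXiv:2207.04232 — 2 statements merged into one kernel-verified Lean document; each statement's English description precedes it below -/
import Mathlib

section
/- Let q = p^m where p is an odd prime and m is a positive integer, and suppose q ≡ 1 (mod 4). Let t be an odd integer with 2 ≤ t ≤ p−1, and let e be an integer with 0 ≤ e ≤ m−1. If η(i(t+1−i)) = 1 for every integer i with 1 ≤ i ≤ (t−1)/2, then there exists an MDS self-dual code over F_q of length (t+1)·p^e. -/
open Finset

/-- The Euclidean dual of a linear code `C ⊆ F^n`. -/
def euclideanDual {F : Type*} [Field F] {n : ℕ} (C : Submodule F (Fin n → F)) :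
    Submodule F (Fin n → F) where
  carrier := {x | ∀ c ∈ C, ∑ i, x i * c i = 0}
  add_mem' := by
    intro a b ha hb c hc
    have h : ∑ i, (a + b) i * c i = (∑ i, a i * c i) + ∑ i, b i * c i := by
      rw [← Finset.sum_add_distrib]
      exact Finset.sum_congr rfl fun i _ => by simp [add_mul]
    simp only [Set.mem_setOf_eq] at *
    rw [h, ha c hc, hb c hc, add_zero]
  zero_mem' := by
    intro c hc
    simp
  smul_mem' := by
    intro r a ha c hc
    have h : ∑ i, (r • a) i * c i = r * ∑ i, a i * c i := by
      rw [Finset.mul_sum]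
      exact Finset.sum_congr rfl fun i _ => by simp [mul_assoc]
    simp only [Set.mem_setOf_eq] at *
    rw [h, ha c hc, mul_zero]

/-- Hamming weight of a word. -/
noncomputable def hWeight {F : Type*} [Field F] {n : ℕ} (c : Fin n → F) : ℕ := Nat.card {i : Fin n // c i ≠ 0}

/-- `C` is an MDS (Euclidean) self-dual code: it equals its Euclidean dual and its
minimum Hamming distance is `n/2 + 1`. -/
def IsMDSSelfDual {F : Type*} [Field F] {n : ℕ} (C : Submodule F (Fin n → F)) : Prop :=
  C = euclideanDual C ∧
  (∀ c ∈ C, c ≠ 0 → n / 2 + 1 ≤ hWeight c) ∧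
  (∃ c ∈ C, c ≠ 0 ∧ hWeight c = n / 2 + 1)

open Classical in
/-- The quadratic character `η` of a field: `1` on nonzero squares, `-1` on nonsquares,
`0` at `0`. -/
noncomputable def quadChar (F : Type*) [Field F] (x : F) : ℤ :=
  if x = 0 then 0 else if IsSquare x then 1 else -1

open Polynomial in
/-- The evaluation map `f ↦ (v i * f (a i))_i` defining generalized Reed-Solomon codes. -/
noncomputable def grsMap {F : Type*} [Field F] {n : ℕ} (a v : Fin n → F) :
    F[X] →ₗ[F] (Fin n → F) :=
  LinearMap.pi fun i => v i • Polynomial.leval (a i)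

@[simp]
theorem grsMap_apply {F : Type*} [Field F] {n : ℕ} (a v : Fin n → F) (f : Polynomial F)
    (i : Fin n) : grsMap a v f i = v i * f.eval (a i) := by
  simp [grsMap]

/-- The weight of a generalized Reed-Solomon codeword, in terms of the zeros of the polynomial. -/
theorem hWeight_grsMap {F : Type*} [Field F] [DecidableEq F] {n : ℕ} {a v : Fin n → F}
    (hv : ∀ i, v i ≠ 0) (f : Polynomial F) :
    hWeight (grsMap a v f) + #{i | f.eval (a i) = 0} = n := by
  have h : hWeight (grsMap a v f) = #{i | ¬ f.eval (a i) = 0} := by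
    simp [hWeight, hv, Nat.card_eq_fintype_card, Fintype.card_subtype]
  rw [h, add_comm, card_filter_add_card_filter_not, card_univ, Fintype.card_fin]

theorem card_zeros_le_natDegree {F : Type*} [Field F] [DecidableEq F] {n : ℕ} {a : Fin n → F}
    (ha : Function.Injective a) {f : Polynomial F} (hf : f ≠ 0) :
    #{i | f.eval (a i) = 0} ≤ f.natDegree := by
  refine le_trans ?_ f.card_roots'
  refine le_trans ?_ (Multiset.toFinset_card_le _)
  rw [← card_image_of_injective _ ha]
  refine card_le_card fun x hx => ?_
  obtain ⟨i, hi, rfl⟩ := mem_image.1 hx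
  simpa [hf] using hi

/-- If `v i ^ 2 * ∏_{j ≠ i} (a i - a j)` does not depend on `i`, the generalized Reed-Solomon code
of dimension `k` and length `2 * k` is an MDS self-dual code. -/
theorem isMDSSelfDual_grs {F : Type*} [Field F] {n k : ℕ} (hn : n = 2 * k) (hk : 0 < k)
    {a v : Fin n → F} (ha : Function.Injective a) {c : F} (hc : c ≠ 0)
    (hv : ∀ i, v i ^ 2 * ∏ j ∈ univ.erase i, (a i - a j) = c) :
    IsMDSSelfDual ((Polynomial.degreeLT F k).map (grsMap a v)) := by
  classical
  have hv0 : ∀ i, v i ≠ 0 := fun i h => hc (by rw [← hv i, h]; simp)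
  have hw0 : ∀ i, ∏ j ∈ univ.erase i, (a i - a j) ≠ 0 := fun i h => hc (by rw [← hv i, h]; simp)
  have hnk : n / 2 = k := by omega
  have key : ∀ f g : Polynomial F, (f * g).degree < n →
      ∑ i, grsMap a v f i * grsMap a v g i = c * (f * g).coeff (n - 1) := by
    intro f g hfg
    have h := Lagrange.coeff_eq_sum (s := (univ : Finset (Fin n))) (v := a) ha.injOn
      (P := f * g) (by simpa using hfg)
    rw [card_univ, Fintype.card_fin] at h
    rw [h, mul_sum]
    refine sum_congr rfl fun i _ => ?_
    have := hw0 i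
    rw [← hv i, grsMap_apply, grsMap_apply, Polynomial.eval_mul]
    field_simp
  refine ⟨le_antisymm ?_ ?_, ?_, ?_⟩
  · rintro _ ⟨f, hf, rfl⟩ _ ⟨g, hg, rfl⟩
    rw [SetLike.mem_coe, Polynomial.mem_degreeLT] at hf hg
    have hd : (f * g).degree < (n - 1 : ℕ) := by
      by_cases hf0 : f = 0
      · simp [hf0]
      by_cases hg0 : g = 0
      · simp [hg0]
      rw [Polynomial.degree_eq_natDegree (mul_ne_zero hf0 hg0), Polynomial.natDegree_mul hf0 hg0]
      rw [Polynomial.degree_eq_natDegree hf0] at hf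
      rw [Polynomial.degree_eq_natDegree hg0] at hg
      norm_cast at *
      omega
    rw [key f g (hd.trans_le (by exact_mod_cast Nat.sub_le _ _)),
      Polynomial.coeff_eq_zero_of_degree_lt hd, mul_zero]
  · intro x hx
    set f := Lagrange.interpolate univ a fun i => x i / v i with hf
    have hfx : grsMap a v f = x := by
      ext i
      rw [grsMap_apply, hf, Lagrange.eval_interpolate_at_node _ ha.injOn (mem_univ i),
        mul_div_cancel₀ _ (hv0 i)]
    have hfn : f.degree < n := by
      simpa only [card_univ, Fintype.card_fin] using
        Lagrange.degree_interpolate_lt (s := univ) (v := a) (fun i => x i / v i) ha.injOn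
    refine ⟨f, ?_, hfx⟩
    rw [SetLike.mem_coe, Polynomial.mem_degreeLT]
    by_contra! hfk
    have hf0 : f ≠ 0 := by
      intro h
      simp [h] at hfk
    rw [Polynomial.degree_eq_natDegree hf0] at hfn hfk
    norm_cast at hfn hfk
    have hd : n - 1 = f.natDegree + (n - 1 - f.natDegree) := by omega
    have h := hx (grsMap a v (Polynomial.X ^ (n - 1 - f.natDegree)))
      ⟨_, by
        rw [SetLike.mem_coe, Polynomial.mem_degreeLT, Polynomial.degree_X_pow]
        norm_cast
        omega, rfl⟩
    rw [← hfx, key] at h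
    · rw [hd, Nat.add_sub_cancel_left, Polynomial.coeff_mul_X_pow] at h
      exact mul_ne_zero hc (Polynomial.leadingCoeff_ne_zero.2 hf0) h
    · rw [Polynomial.degree_mul, Polynomial.degree_X_pow, Polynomial.degree_eq_natDegree hf0]
      norm_cast
      omega
  · rintro _ ⟨f, hf, rfl⟩ hne
    have hf0 : f ≠ 0 := by
      rintro rfl
      simp at hne
    rw [SetLike.mem_coe, Polynomial.mem_degreeLT, Polynomial.degree_eq_natDegree hf0] at hf
    norm_cast at hf
    have h1 := hWeight_grsMap (a := a) hv0 f
    have h2 := card_zeros_le_natDegree ha hf0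
    omega
  · obtain ⟨s, -, hs⟩ := exists_subset_card_eq (s := (univ : Finset (Fin n))) (n := k - 1)
      (by simp; omega)
    have hw : hWeight (grsMap a v (Lagrange.nodal s a)) = n / 2 + 1 := by
      have h1 := hWeight_grsMap (a := a) hv0 (Lagrange.nodal s a)
      have h2 : ({i | (Lagrange.nodal s a).eval (a i) = 0} : Finset (Fin n)) = s := by
        ext i
        simp [Lagrange.eval_nodal, prod_eq_zero_iff, sub_eq_zero, ha.eq_iff]
      rw [h2, hs] at h1
      omega
    refine ⟨_, ⟨Lagrange.nodal s a, ?_, rfl⟩, ?_, hw⟩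
    · rw [SetLike.mem_coe, Polynomial.mem_degreeLT, Lagrange.degree_nodal, hs]
      norm_cast
      omega
    · intro h
      rw [h] at hw
      simp [hWeight] at hw

/-- Existence of an MDS self-dual code from a family of evaluation points whose difference
products all lie in the same square class. -/
theorem exists_isMDSSelfDual_of_isSquare {F ι : Type*} [Field F] [Fintype ι] [DecidableEq ι]
    {n : ℕ} (hcard : Fintype.card ι = n) (hn : Even n) {a : ι → F} (ha : Function.Injective a)
    (x₀ : ι) (h : ∀ x, IsSquare ((∏ y ∈ univ.erase x, (a x - a y)) *
      ∏ y ∈ univ.erase x₀, (a x₀ - a y))) :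
    ∃ C : Submodule F (Fin n → F), IsMDSSelfDual C := by
  obtain ⟨k, hk⟩ := hn
  have hn0 : 0 < n := hcard ▸ Fintype.card_pos_iff.2 ⟨x₀⟩
  have hw0 : ∀ x, ∏ y ∈ univ.erase x, (a x - a y) ≠ 0 := fun x =>
    prod_ne_zero_iff.2 fun y hy => sub_ne_zero.2 fun hxy => (mem_erase.1 hy).1 (ha hxy).symm
  choose s hs using h
  let E : Fin n ≃ ι := (Fintype.equivFinOfCardEq hcard).symm
  refine ⟨_, isMDSSelfDual_grs (k := k) (by omega) (by omega) (ha.comp E.injective) (hw0 x₀)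
    (v := fun i => s (E i) / ∏ y ∈ univ.erase (E i), (a (E i) - a y)) fun i => ?_⟩
  have hE : ∏ j ∈ univ.erase i, ((a ∘ E) i - (a ∘ E) j) =
      ∏ y ∈ univ.erase (E i), (a (E i) - a y) :=
    prod_equiv E (by simp) (by simp)
  have := hw0 (E i)
  rw [hE, div_pow, sq (s _), ← hs]
  field_simp

/-- Multiplication by an integer prime to the characteristic permutes a finite additive subgroup
of a field. -/
theorem bijective_zsmul_of_intCast_ne_zero {F : Type*} [Field F] (H : AddSubgroup F) [Finite H]
    {k : ℤ} (hk : (k : F) ≠ 0) : Function.Bijective fun h : H => k • h := by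
  refine Finite.injective_iff_bijective.1 fun x y hxy => Subtype.ext ?_
  have := congrArg ((↑) : H → F) hxy
  simpa [hk] using this

theorem prod_intCast_mul_add_sub {F : Type*} [Field F] (H : AddSubgroup F) [Fintype H]
    {k : ℤ} (hk : (k : F) ≠ 0) (β : F) (h : H) :
    ∏ h' : H, (k * β + h - h') = (k : F) ^ Fintype.card H * ∏ h' : H, (β + h') := by
  let e : H ≃ H := (Equiv.ofBijective _ (bijective_zsmul_of_intCast_ne_zero H hk)).trans
    (Equiv.subLeft h)
  rw [← e.prod_comp, ← card_univ, ← prod_const, ← prod_mul_distrib]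
  refine prod_congr rfl fun x _ => ?_
  simp [e]
  ring

theorem isSquare_factorial_mul {F : Type*} [Field F] {t : ℕ}
    (ht0 : ∀ i, 0 < i → i ≤ t → (i : F) ≠ 0)
    (hsq : ∀ i : ℕ, 1 ≤ i → i ≤ t → IsSquare ((i : F) * (t + 1 - i : ℕ))) {i : ℕ} (hi : i ≤ t) :
    IsSquare ((i.factorial : F) * (t - i).factorial * t.factorial) := by
  induction i with
  | zero => simp
  | succ i ih =>
    have h0 : ((t - i : ℕ) : F) ≠ 0 := ht0 _ (by omega) (by omega)
    have hf : (t - i).factorial = (t - i) * (t - (i + 1)).factorial := by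
      rw [← Nat.mul_factorial_pred (by omega), Nat.sub_sub]
    have h := ((ih (by omega)).mul (hsq (i + 1) (by omega) hi)).div
      (IsSquare.mul_self ((t - i : ℕ) : F))
    rw [hf, Nat.add_sub_add_right] at h
    rw [Nat.factorial_succ]
    refine (congrArg IsSquare ?_).mp h
    rw [div_eq_iff (mul_ne_zero h0 h0)]
    push_cast
    ring

theorem prod_range_erase_sub {R : Type*} [CommRing R] {t i : ℕ} (hi : i ≤ t) :
    ∏ j ∈ (range (t + 1)).erase i, ((i : R) - j) =
      (-1) ^ (t - i) * (i.factorial * (t - i).factorial) := by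
  have hset : (range (t + 1)).erase i = range i ∪ Ico (i + 1) (t + 1) := by
    ext j
    simp only [mem_erase, mem_range, mem_union, mem_Ico]
    omega
  rw [hset, prod_union (disjoint_left.2 fun j => by simp; omega), prod_Ico_eq_prod_range]
  have h1 : ∏ j ∈ range i, ((i : R) - j) = i.factorial := by
    rw [← prod_range_add_one_eq_factorial, ← prod_range_reflect, Nat.cast_prod]
    refine prod_congr rfl fun j hj => ?_
    rw [sub_eq_iff_eq_add, ← Nat.cast_add]
    congr 1
    have := mem_range.1 hj
    omega
  have h2 : ∏ j ∈ range (t + 1 - (i + 1)), ((i : R) - (i + 1 + j : ℕ)) =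
      (-1) ^ (t - i) * (t - i).factorial := by
    rw [Nat.add_sub_add_right, ← prod_range_add_one_eq_factorial, Nat.cast_prod]
    conv_rhs => rw [← card_range (t - i), ← prod_const, card_range, ← prod_mul_distrib]
    refine prod_congr rfl fun j _ => ?_
    push_cast
    ring
  rw [h1, h2]
  ring

theorem prod_erase_coset {F : Type*} [Field F] {t : ℕ} (ht0 : ∀ i, 0 < i → i ≤ t → (i : F) ≠ 0)
    (H : AddSubgroup F) [Fintype H] [DecidableEq H] (β : F) (x : Fin (t + 1) × H) :
    ∏ y ∈ univ.erase x, ((x.1 : ℕ) * β + x.2 - ((y.1 : ℕ) * β + y.2)) =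
      (∏ j ∈ univ.erase x.1, (((x.1 : ℕ) : F) - (j : ℕ))) ^ Fintype.card H *
        ((∏ h : H, (β + h)) ^ t * ∏ h ∈ univ.erase (0 : H), (h : F)) := by
  obtain ⟨i, h⟩ := x
  have hset : univ.erase (i, h) = (univ.erase i ×ˢ univ) ∪ ({i} ×ˢ univ.erase h) := by
    ext ⟨j, h'⟩
    simp only [mem_erase, mem_univ, mem_union, mem_product, mem_singleton, ne_eq, Prod.mk.injEq]
    tauto
  have hdisj : Disjoint (univ.erase i ×ˢ (univ : Finset H)) ({i} ×ˢ univ.erase h) := by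
    rw [disjoint_left]
    rintro ⟨j, h'⟩ hj hj'
    exact (mem_erase.1 (mem_product.1 hj).1).1 (mem_singleton.1 (mem_product.1 hj').1)
  have h1 : ∀ j ∈ univ.erase i, ∏ h' : H, ((i : ℕ) * β + h - ((j : ℕ) * β + h')) =
      (((i : ℕ) : F) - (j : ℕ)) ^ Fintype.card H * ∏ h : H, (β + h) := by
    intro j hj
    have hij : (((i : ℤ) - (j : ℤ) : ℤ) : F) ≠ 0 := by
      have hne : (i : ℕ) ≠ j := fun h => (mem_erase.1 hj).1 (Fin.ext h).symm
      intro h0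
      push_cast at h0
      rcases lt_or_gt_of_ne hne with hlt | hlt
      · refine ht0 (j - i) (by omega) (by omega) ?_
        rw [Nat.cast_sub hlt.le]
        linear_combination -h0
      · refine ht0 (i - j) (by omega) (by omega) ?_
        rw [Nat.cast_sub hlt.le]
        linear_combination h0
    have := prod_intCast_mul_add_sub H hij β h
    push_cast at this
    rw [← this]
    refine prod_congr rfl fun h' _ => ?_
    ring
  have h2 : ∏ h' ∈ univ.erase h, ((i : ℕ) * β + h - ((i : ℕ) * β + h')) =
      ∏ h ∈ univ.erase (0 : H), (h : F) :=
    prod_equiv (Equiv.subLeft h) (by simp [sub_eq_zero, eq_comm]) (by simp)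
  rw [hset, prod_union hdisj, prod_product, prod_product, prod_singleton, h2, prod_congr rfl h1,
    prod_mul_distrib, prod_pow, prod_const, card_erase_of_mem (mem_univ i), card_univ,
    Fintype.card_fin, Nat.add_sub_cancel, mul_assoc]

/-- Distinct translates of `H` by small multiples of `β ∉ H` are disjoint. -/
theorem injective_natCast_mul_add {F : Type*} [Field F] {t : ℕ}
    (ht0 : ∀ i, 0 < i → i ≤ t → (i : F) ≠ 0) (H : AddSubgroup F) [Finite H] {β : F} (hβ : β ∉ H) :
    Function.Injective fun x : Fin (t + 1) × H => (x.1 : ℕ) * β + (x.2 : F) := by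
  have key : ∀ (i j : Fin (t + 1)) (h h' : H), i < j →
      (i : ℕ) * β + (h : F) ≠ (j : ℕ) * β + (h' : F) := by
    intro i j h h' hij heq
    have hk : (((j - i : ℕ) : ℤ) : F) ≠ 0 := by
      rw [Int.cast_natCast]
      exact ht0 _ (Nat.sub_pos_of_lt hij) (by omega)
    obtain ⟨x, hx⟩ := (bijective_zsmul_of_intCast_ne_zero H hk).surjective (h - h')
    have hx' := congrArg ((↑) : H → F) hx
    simp only [AddSubgroup.coe_zsmul, AddSubgroup.coe_sub, zsmul_eq_mul] at hx'
    have : (x : F) = β := by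
      refine mul_left_cancel₀ hk ?_
      rw [hx', Int.cast_natCast, Nat.cast_sub hij.le]
      linear_combination heq
    exact hβ (this ▸ x.2)
  rintro ⟨i, h⟩ ⟨j, h'⟩ heq
  rcases lt_trichotomy i j with hij | rfl | hij
  · exact absurd heq (key i j h h' hij)
  · simpa using heq
  · exact absurd heq.symm (key j i h' h hij)

theorem exists_addSubgroup_card_eq_pow {G : Type*} [AddGroup G] [Finite G] {p e : ℕ}
    (hp : p.Prime) (h : p ^ e ∣ Nat.card G) : ∃ H : AddSubgroup G, Nat.card H = p ^ e := by
  have := Fact.mk hp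
  obtain ⟨K, hK⟩ := Sylow.exists_subgroup_card_pow_prime (G := Multiplicative G) p h
  exact ⟨Subgroup.toAddSubgroup' K, hK⟩

theorem isSquare_of_quadChar_eq_one {F : Type*} [Field F] {x : F} (h : quadChar F x = 1) :
    IsSquare x := by
  unfold quadChar at h
  split_ifs at h with h0 h1
  · simp at h
  · exact h1

theorem stmt_2 (p m e t : ℕ) (hp : p.Prime) (hpodd : Odd p) (hm : 0 < m) (he : e ≤ m - 1)
    (hq4 : p ^ m % 4 = 1) (ht : Odd t) (ht2 : 2 ≤ t) (htp : t ≤ p - 1)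
    (F : Type*) [Field F] [Fintype F] (hF : Fintype.card F = p ^ m)
    (hchi : ∀ i : ℕ, 1 ≤ i → i ≤ (t - 1) / 2 →
      quadChar F ((i * (t + 1 - i) : ℕ) : F) = 1) :
    ∃ C : Submodule F (Fin ((t + 1) * p ^ e) → F), IsMDSSelfDual C := by
  classical
  have := Fact.mk hp
  have hchar : CharP F p := charP_of_card_eq_prime_pow hF
  have hp2 := Nat.odd_iff.1 hpodd
  have ht0 : ∀ i, 0 < i → i ≤ t → (i : F) ≠ 0 := by
    intro i hi hit h
    have := Nat.le_of_dvd hi ((CharP.cast_eq_zero_iff F p i).1 h)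
    omega
  have hneg : IsSquare (-1 : F) := FiniteField.isSquare_neg_one_iff.2 (by omega)
  have hsq : ∀ i : ℕ, 1 ≤ i → i ≤ t → IsSquare ((i : F) * (t + 1 - i : ℕ)) := by
    intro i hi hit
    have ht' := Nat.odd_iff.1 ht
    rcases lt_trichotomy (2 * i) (t + 1) with h | h | h
    · exact_mod_cast isSquare_of_quadChar_eq_one (hchi i hi (by omega))
    · rw [show t + 1 - i = i by omega]
      exact IsSquare.mul_self _
    · have := isSquare_of_quadChar_eq_one (hchi (t + 1 - i) (by omega) (by omega))
      rw [Nat.sub_sub_self (by omega), mul_comm] at this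
      exact_mod_cast this
  obtain ⟨H, hH⟩ := exists_addSubgroup_card_eq_pow (G := F) (e := e) hp
    (by rw [Nat.card_eq_fintype_card, hF]; exact pow_dvd_pow p (by omega))
  obtain ⟨β, hβ⟩ : ∃ β, β ∉ H := by
    by_contra! h
    rw [(AddSubgroup.eq_top_iff' H).2 h, AddSubgroup.card_top, Nat.card_eq_fintype_card, hF] at hH
    have := Nat.pow_right_injective hp.two_le hH
    omega
  have hD : ∀ i : Fin (t + 1), IsSquare
      ((∏ j ∈ univ.erase i, (((i : ℕ) : F) - (j : ℕ))) * (t.factorial : F)) := by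
    intro i
    have hr : ∏ j ∈ univ.erase i, (((i : ℕ) : F) - (j : ℕ)) =
        ∏ j ∈ (range (t + 1)).erase i, (((i : ℕ) : F) - j) := by
      refine prod_bij (fun j _ => (j : ℕ)) ?_ ?_ ?_ ?_
      · intro j hj
        simpa [Fin.ext_iff, Nat.lt_succ_iff, Fin.is_le] using hj
      · intro j _ k _ h
        exact Fin.ext h
      · intro j hj
        rw [mem_erase, mem_range] at hj
        exact ⟨⟨j, hj.2⟩, by simpa [Fin.ext_iff] using hj.1, rfl⟩
      · intro j _
        rfl
    rw [hr, prod_range_erase_sub i.is_le, mul_assoc]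
    exact (hneg.pow _).mul (isSquare_factorial_mul ht0 hsq i.is_le)
  have htf : (t.factorial : F) ≠ 0 := by
    rw [← prod_range_add_one_eq_factorial, Nat.cast_prod]
    exact prod_ne_zero_iff.2 fun j hj => ht0 _ (by omega) (mem_range.1 hj)
  refine exists_isMDSSelfDual_of_isSquare (ι := Fin (t + 1) × H) ?_ (ht.add_one.mul_right _)
    (injective_natCast_mul_add ht0 H hβ) (0, 0) fun x => ?_
  · rw [Fintype.card_prod, Fintype.card_fin, ← Nat.card_eq_fintype_card, hH]
  · rw [prod_erase_coset ht0, prod_erase_coset ht0, mul_mul_mul_comm, ← mul_pow]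
    refine IsSquare.mul (IsSquare.pow _ ?_) (IsSquare.mul_self _)
    convert ((hD x.1).mul (hD 0)).div (IsSquare.mul_self (t.factorial : F)) using 1
    field_simp
end

section
/- Let q = r^{sm} where r is an odd prime power, m is an odd positive integer and s is a positive integer. Let t be an odd integer dividing r−1 with η(−t) = 1, and let e be an integer with 0 ≤ e ≤ s−1. Then there exists an MDS self-dual code over F_q of length (t+1)·r^e·(1 + r^s + r^{2s} + ⋯ + r^{s(m−1)}). -/
open Finset

open Polynomial in
/-- The generalized Reed-Solomon code of dimension `k` with evaluation points `a` and column
multipliers `v`. -/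
noncomputable def grsCode {F : Type*} [Field F] {n : ℕ} (k : ℕ) (a v : Fin n → F) :
    Submodule F (Fin n → F) :=
  (degreeLT F k).map (LinearMap.pi fun i => v i • leval (a i))

section GRS

open Polynomial

variable {F : Type*} [Field F] {n : ℕ}

theorem mem_grsCode {k : ℕ} {a v : Fin n → F} {c : Fin n → F} :
    c ∈ grsCode k a v ↔ ∃ P : F[X], P.degree < k ∧ c = fun i => v i * P.eval (a i) := by
  simp only [grsCode, Submodule.mem_map, mem_degreeLT]
  refine exists_congr fun P => and_congr_right fun _ => ⟨fun h => ?_, fun h => ?_⟩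
  · rw [← h]; ext i; simp [leval]
  · rw [h]; ext i; simp [leval]

theorem hWeight_add_card_zeros (c : Fin n → F) :
    hWeight c + Nat.card {i : Fin n // c i = 0} = n := by
  classical
  have := Fintype.card_subtype_compl (fun i : Fin n => c i = 0)
  have hle := Fintype.card_subtype_le (fun i : Fin n => c i = 0)
  simp only [hWeight, Nat.card_eq_fintype_card, Fintype.card_fin] at *
  simp only [ne_eq]
  omega

theorem le_hWeight_of_mem_grsCode {k : ℕ} {a v : Fin n → F} (ha : Function.Injective a)
    (hv : ∀ i, v i ≠ 0) {c : Fin n → F} (hc : c ∈ grsCode k a v) (hc0 : c ≠ 0) :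
    n + 1 ≤ hWeight c + k := by
  classical
  obtain ⟨P, hP, rfl⟩ := mem_grsCode.1 hc
  have hP0 : P ≠ 0 := by
    rintro rfl
    exact hc0 (by ext; simp)
  have h1 := hWeight_add_card_zeros fun i => v i * P.eval (a i)
  have h2 : Nat.card {i : Fin n // v i * P.eval (a i) = 0} < k := by
    rw [Nat.card_eq_fintype_card, Fintype.card_subtype]
    by_contra! hle
    refine hP0 (eq_zero_of_degree_lt_of_eval_index_eq_zero (s := {i | v i * P.eval (a i) = 0})
      ha.injOn (hP.trans_le (by exact_mod_cast hle)) fun i hi => ?_)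
    simpa [hv i] using hi
  omega

theorem exists_mem_grsCode_hWeight_eq {k : ℕ} (hk : 0 < k) (hkn : k ≤ n) {a v : Fin n → F}
    (ha : Function.Injective a) (hv : ∀ i, v i ≠ 0) :
    ∃ c ∈ grsCode k a v, c ≠ 0 ∧ hWeight c + k = n + 1 := by
  classical
  obtain ⟨s, -, hs⟩ := Finset.exists_subset_card_eq (s := (univ : Finset (Fin n))) (n := k - 1)
    (by simp; omega)
  have hz : ∀ i, v i * (Lagrange.nodal s a).eval (a i) = 0 ↔ i ∈ s := fun i => by
    simp [hv i, Lagrange.eval_nodal, Finset.prod_eq_zero_iff, sub_eq_zero, ha.eq_iff]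
  have h1 := hWeight_add_card_zeros fun i => v i * (Lagrange.nodal s a).eval (a i)
  simp only [hz, Nat.card_eq_fintype_card, Fintype.card_coe, hs] at h1
  refine ⟨_, mem_grsCode.2 ⟨Lagrange.nodal s a, ?_, rfl⟩, fun h0 => ?_, by omega⟩
  · rw [Lagrange.degree_nodal, hs]
    exact_mod_cast (by omega : k - 1 < k)
  · have : s = univ := by
      ext i
      simpa [hz] using congrFun h0 i
    rw [this, Finset.card_univ, Fintype.card_fin] at hs
    omega

theorem grsCode_eq_euclideanDual {k : ℕ} {a v : Fin (k + k) → F} (ha : Function.Injective a)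
    {μ : F} (hμ : μ ≠ 0) (hv : ∀ i, v i ^ 2 = μ / ∏ j ∈ univ.erase i, (a i - a j)) :
    grsCode k a v = euclideanDual (grsCode k a v) := by
  have key : ∀ P Q : F[X], (P * Q).degree < (k + k : ℕ) →
      ∑ i, (v i * P.eval (a i)) * (v i * Q.eval (a i)) = μ * (P * Q).coeff (k + k - 1) := by
    intro P Q h
    have := Lagrange.coeff_eq_sum (s := (univ : Finset (Fin (k + k)))) (v := a) ha.injOn
      (P := P * Q) (by simpa using h)
    rw [card_univ, Fintype.card_fin] at this
    rw [this, mul_sum]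
    refine sum_congr rfl fun i _ => ?_
    rw [mul_mul_mul_comm, ← sq, hv, eval_mul]
    ring
  have hv0 : ∀ i, v i ≠ 0 := fun i h => by
    have := hv i
    rw [h, zero_pow two_ne_zero] at this
    refine div_ne_zero hμ (prod_ne_zero_iff.2 fun j hj => ?_) this.symm
    exact sub_ne_zero.2 fun h => (ne_of_mem_erase hj) (ha h.symm)
  have hdeg : ∀ {P : F[X]} {l : ℕ}, P ≠ 0 → (P.degree < l ↔ P.natDegree < l) := fun h =>
    (natDegree_lt_iff_degree_lt h).symm
  apply le_antisymm
  · intro x hx y hy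
    obtain ⟨P, hP, rfl⟩ := mem_grsCode.1 hx
    obtain ⟨Q, hQ, rfl⟩ := mem_grsCode.1 hy
    by_cases hP0 : P = 0
    · simp [hP0]
    by_cases hQ0 : Q = 0
    · simp [hQ0]
    rw [hdeg hP0] at hP
    rw [hdeg hQ0] at hQ
    have hlt : (P * Q).natDegree < k + k - 1 := by
      rw [natDegree_mul hP0 hQ0]
      omega
    rw [key P Q ((hdeg (mul_ne_zero hP0 hQ0)).2 (by omega)),
      coeff_eq_zero_of_natDegree_lt hlt, mul_zero]
  · intro x hx
    set P : F[X] := Lagrange.interpolate univ a fun i => x i / v i with hPdef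
    have hPx : x = fun i => v i * P.eval (a i) := by
      ext i
      rw [hPdef, Lagrange.eval_interpolate_at_node _ ha.injOn (mem_univ i),
        mul_div_cancel₀ _ (hv0 i)]
    have hPdeg : P.degree < (k + k : ℕ) := by
      have := Lagrange.degree_interpolate_lt (s := univ) (fun i => x i / v i) ha.injOn
      rwa [card_univ, Fintype.card_fin] at this
    refine mem_grsCode.2 ⟨P, ?_, hPx⟩
    by_cases hP0 : P = 0
    · simp [hP0]
    rw [hdeg hP0] at hPdeg ⊢
    by_contra! hle
    obtain ⟨l, hl⟩ : ∃ l, P.natDegree + l = k + k - 1 := ⟨k + k - 1 - P.natDegree, by omega⟩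
    have hX : (X ^ (l) : F[X]).degree < k := by
      rw [degree_X_pow]
      exact_mod_cast (by omega)
    have hmul : (P * X ^ l).natDegree = k + k - 1 := by
      rw [natDegree_mul_X_pow _ hP0, hl]
    have h0 := hx _ (mem_grsCode.2 ⟨_, hX, rfl⟩)
    rw [hPx, key _ _ ((hdeg (mul_ne_zero hP0 (pow_ne_zero _ X_ne_zero))).2 (by omega))] at h0
    have hc := (mul_eq_zero.1 h0).resolve_left hμ
    rw [← hmul, coeff_natDegree, leadingCoeff_eq_zero] at hc
    exact mul_ne_zero hP0 (pow_ne_zero _ X_ne_zero) hc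

theorem exists_isMDSSelfDual_of_isSquare_s7 [DecidableEq F] (S : Finset F) (hcard : #S = n)
    (hn : Even n) (hn0 : 0 < n) {μ : F} (hμ : μ ≠ 0)
    (hsq : ∀ x ∈ S, IsSquare (μ * ∏ y ∈ S.erase x, (x - y))) :
    ∃ C : Submodule F (Fin n → F), IsMDSSelfDual C := by
  obtain ⟨k, rfl⟩ := hn
  let e : Fin (k + k) ≃ S := (S.equivFinOfCardEq hcard).symm
  let a : Fin (k + k) → F := fun i => e i
  have ha : Function.Injective a := Subtype.val_injective.comp e.injective
  have himg : ∀ i, (univ.erase i).image a = S.erase (a i) := fun i => by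
    rw [image_erase ha]
    congr 1
    ext x
    simp only [mem_image, mem_univ, true_and, a]
    exact ⟨fun ⟨i, hi⟩ => hi ▸ (e i).2, fun hx => ⟨e.symm ⟨x, hx⟩, by simp⟩⟩
  have hprod : ∀ i, ∏ y ∈ S.erase (a i), (a i - y) = ∏ j ∈ univ.erase i, (a i - a j) := fun i => by
    rw [← himg, prod_image ha.injOn]
  have hprod0 : ∀ i, ∏ j ∈ univ.erase i, (a i - a j) ≠ 0 := fun i =>
    prod_ne_zero_iff.2 fun j hj => sub_ne_zero.2 fun h => (ne_of_mem_erase hj) (ha h.symm)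
  have hex : ∀ i, ∃ u, μ * ∏ j ∈ univ.erase i, (a i - a j) = u * u := fun i => by
    rw [← hprod]
    exact hsq _ (e i).2
  choose u hu using hex
  have hu0 : ∀ i, u i ≠ 0 := fun i h => by
    have := hu i
    rw [h, mul_zero] at this
    exact mul_ne_zero hμ (hprod0 i) this
  have hv : ∀ i, (u i)⁻¹ ^ 2 = μ⁻¹ / ∏ j ∈ univ.erase i, (a i - a j) := fun i => by
    rw [inv_pow, sq, ← hu, mul_inv, div_eq_mul_inv]
  have hv0 : ∀ i, (u i)⁻¹ ≠ 0 := fun i => inv_ne_zero (hu0 i)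
  refine ⟨grsCode k a fun i => (u i)⁻¹, grsCode_eq_euclideanDual ha (inv_ne_zero hμ) hv, ?_, ?_⟩
  · intro c hc hc0
    have := le_hWeight_of_mem_grsCode ha hv0 hc hc0
    omega
  · obtain ⟨c, hc, hc0, hw⟩ :=
      exists_mem_grsCode_hWeight_eq (k := k) (by omega) (by omega) ha hv0
    exact ⟨c, hc, hc0, by omega⟩

end GRS

section Points

open Polynomial

theorem exists_nodal_eq_of_dvd {K : Type*} [Field K] [Fintype K] {f : K[X]}
    (hf : f.Monic) (hdvd : f ∣ X ^ Fintype.card K - X) :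
    ∃ S : Finset K, Lagrange.nodal S id = f := by
  have h0 : (X ^ Fintype.card K - X : K[X]) ≠ 0 :=
    FiniteField.X_pow_card_sub_X_ne_zero K Fintype.one_lt_card
  have hs : f.Splits := by
    refine Splits.of_dvd ?_ h0 hdvd
    rw [splits_iff_card_roots, FiniteField.roots_X_pow_card_sub_X,
      FiniteField.X_pow_card_sub_X_natDegree_eq K Fintype.one_lt_card]
    rfl
  have hle := roots.le_of_dvd h0 hdvd
  rw [FiniteField.roots_X_pow_card_sub_X] at hle
  refine ⟨⟨f.roots, Multiset.nodup_of_le hle univ.nodup⟩, ?_⟩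
  exact (hs.eq_prod_roots_of_monic hf).symm

theorem eval_derivative_nodal_id {K : Type*} [Field K] [DecidableEq K] {S : Finset K} {x : K}
    (hx : x ∈ S) :
    (derivative (Lagrange.nodal S id)).eval x = ∏ y ∈ S.erase x, (x - y) := by
  have := Lagrange.eval_nodal_derivative_eval_node_eq (v := id) hx
  rw [id, Lagrange.eval_nodal] at this
  exact this

theorem exists_card_eq_prod_sub_eq {K : Type*} [Field K] [Fintype K] [DecidableEq K] {t : ℕ}
    (ht : 0 < t) (hdvd : t ∣ Fintype.card K - 1) :
    ∃ B : Finset K, #B = t + 1 ∧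
      ∀ b ∈ B, ∏ c ∈ B.erase b, (b - c) = -1 ∨ ∏ c ∈ B.erase b, (b - c) = t := by
  have hmonic : (X * (X ^ t - 1) : K[X]).Monic :=
    monic_X.mul (by simpa using monic_X_pow_sub_C (1 : K) ht.ne')
  have hcard : Fintype.card K = Fintype.card K - 1 + 1 :=
    (Nat.sub_add_cancel Fintype.card_pos).symm
  obtain ⟨B, hB⟩ := exists_nodal_eq_of_dvd hmonic (by
    obtain ⟨c, hc⟩ := hdvd
    rw [hcard, pow_succ', ← mul_sub_one, hc, pow_mul]
    exact mul_dvd_mul_left _ (by simpa using sub_dvd_pow_sub_pow (X ^ t : K[X]) 1 c))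
  refine ⟨B, ?_, fun b hb => ?_⟩
  · rw [← Lagrange.natDegree_nodal (s := B) (v := (id : K → K)), hB, natDegree_X_mul,
      ← C_1, natDegree_X_pow_sub_C]
    rw [← C_1]
    exact (monic_X_pow_sub_C (1 : K) ht.ne').ne_zero
  · have hroot : eval b (X * (X ^ t - 1) : K[X]) = 0 := by
      rw [← hB]
      exact Lagrange.eval_nodal_at_node (v := id) hb
    rw [← eval_derivative_nodal_id hb, hB]
    simp only [eval_mul, eval_X, eval_sub, eval_pow, eval_one, mul_eq_zero] at hroot
    simp only [derivative_mul, derivative_X, derivative_sub, derivative_X_pow, derivative_one,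
      eval_add, eval_mul, eval_sub, eval_pow, eval_X, eval_one, eval_C, one_mul,
      sub_zero]
    rcases hroot with rfl | h
    · left
      simp [ht.ne']
    · right
      obtain ⟨l, rfl⟩ := Nat.exists_eq_succ_of_ne_zero ht.ne'
      rw [h, zero_add, Nat.succ_sub_one]
      rw [Nat.succ_eq_add_one, pow_succ'] at h
      linear_combination (l + 1 : ℕ) * h

theorem exists_submodule_finrank_eq {K V : Type*} [Field K] [AddCommGroup V] [Module K V]
    [Module.Finite K V] {e : ℕ} (he : e ≤ Module.finrank K V) :
    ∃ W : Submodule K V, Module.finrank K W = e := by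
  let b := Module.finBasis K V
  refine ⟨Submodule.span K (Set.range (b ∘ Fin.castLE he)), ?_⟩
  rw [finrank_span_eq_card (b.linearIndependent.comp _ (Fin.castLE_injective he)),
    Fintype.card_fin]

/-- The set of points `v + b c - z`, with `v` in a subspace `V` of dimension `e`, `b ∈ B` and
`c ∉ V`: up to a common factor, its difference products are those of `B`. -/
theorem exists_translates {K E : Type*} [Field K] [Fintype K] [Field E] [Fintype E]
    [Algebra K E] [DecidableEq K] [DecidableEq E] (B : Finset K) (hB : #B < Fintype.card K) {e : ℕ}
    (he : e < Module.finrank K E) :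
    ∃ W : Finset E, #W = #B * Fintype.card K ^ e ∧ (0 : E) ∉ W ∧ ∃ D : E, D ≠ 0 ∧
      ∀ w ∈ W, ∃ b ∈ B,
        ∏ w' ∈ W.erase w, (w - w') = D * algebraMap K E (∏ b' ∈ B.erase b, (b - b')) := by
  classical
  obtain ⟨V, hV⟩ := exists_submodule_finrank_eq he.le
  have hVcard : Fintype.card V = Fintype.card K ^ e := by
    rw [Module.card_eq_pow_finrank (K := K), hV]
  obtain ⟨c, hc⟩ : ∃ c, c ∉ V := by
    by_contra! h
    rw [(Submodule.eq_top_iff').2 h, finrank_top] at hV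
    omega
  have hcV : ∀ (β : K) (u : V), β ≠ 0 → (u : E) + β • c ≠ 0 := fun β u hβ h => hc <| by
    rw [← V.smul_mem_iff hβ, eq_neg_of_add_eq_zero_right h]
    exact V.neg_mem u.2
  let φ : V × K → E := fun x => x.1 + x.2 • c
  have hsub : ∀ x y, φ x - φ y = ((x.1 - y.1 : V) : E) + (x.2 - y.2) • c := fun x y => by
    simp only [φ, Submodule.coe_sub, sub_smul]
    abel
  have hφ : Function.Injective φ := fun x y h => by
    have h1 := hsub x y
    rw [h, sub_self] at h1
    have h2 : x.2 = y.2 := by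
      by_contra h2
      exact hcV _ _ (sub_ne_zero.2 h2) h1.symm
    rw [h2, sub_self, zero_smul, add_zero] at h1
    exact Prod.ext (sub_eq_zero.1 (Subtype.ext h1.symm)) h2
  let P : Finset (V × K) := univ ×ˢ B
  have hPcard : #P = #B * Fintype.card K ^ e := by
    rw [card_product, card_univ, hVcard, mul_comm]
  obtain ⟨z, hz⟩ : ∃ z, z ∉ P.image φ := by
    by_contra! h
    have h1 : #(P.image φ) = Fintype.card E := by
      rw [eq_univ_of_forall h, card_univ]
    rw [card_image_of_injective _ hφ, hPcard, Module.card_eq_pow_finrank (K := K) (V := E)] at h1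
    have h2 : Fintype.card K ^ (e + 1) ≤ Fintype.card K ^ Module.finrank K E :=
      Nat.pow_le_pow_right Fintype.card_pos he
    rw [← h1, pow_succ', Nat.mul_le_mul_right_iff (pow_pos Fintype.card_pos _)] at h2
    omega
  let ψ : V × K → E := fun x => φ x - z
  have hψ : Function.Injective ψ := fun x y h => hφ (sub_left_injective h)
  have hψsub : ∀ x y, ψ x - ψ y = ((x.1 - y.1 : V) : E) + (x.2 - y.2) • c := fun x y => by
    rw [← hsub, sub_sub_sub_cancel_right]
  let A : E := ∏ u : V, if u = 0 then 1 else (u : E)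
  let M : E := ∏ u : V, ((u : E) + c)
  have hA : A ≠ 0 := prod_ne_zero_iff.2 fun u _ => by
    split_ifs with h
    · exact one_ne_zero
    · simpa using h
  have hM : M ≠ 0 := prod_ne_zero_iff.2 fun u _ => by simpa using hcV 1 u one_ne_zero
  have hscale : ∀ β : K, β ≠ 0 → ∏ u : V, ((u : E) + β • c) = algebraMap K E β * M := by
    intro β hβ
    let σ : V ≃ V := (LinearEquiv.smulOfNeZero K V β hβ).toEquiv
    rw [← σ.prod_comp]
    have : ∀ u : V, ((σ u : V) : E) + β • c = algebraMap K E β * (u + c) := fun u => by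
      rw [← Algebra.smul_def, smul_add]
      rfl
    simp only [this, prod_mul_distrib, prod_const, card_univ, hVcard]
    rw [← map_pow, FiniteField.pow_card_pow]
  refine ⟨P.image ψ, ?_, ?_, A * M ^ (#B - 1), mul_ne_zero hA (pow_ne_zero _ hM), ?_⟩
  · rw [card_image_of_injective _ hψ, hPcard]
  · simpa [ψ, sub_eq_zero] using hz
  · intro w hw
    obtain ⟨⟨v, b⟩, hx, rfl⟩ := mem_image.1 hw
    have hb : b ∈ B := (mem_product.1 hx).2
    refine ⟨b, hb, ?_⟩
    let g : V × K → E := fun y => if y = (v, b) then 1 else ψ (v, b) - ψ y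
    have hg : g (v, b) = 1 := if_pos rfl
    rw [← image_erase hψ, prod_image hψ.injOn]
    calc ∏ y ∈ P.erase (v, b), (ψ (v, b) - ψ y)
        = ∏ y ∈ P.erase (v, b), g y :=
          prod_congr rfl fun y hy => (if_neg (ne_of_mem_erase hy)).symm
      _ = ∏ y ∈ P, g y := prod_erase _ hg
      _ = ∏ b' ∈ B, ∏ u : V, g (u, b') := prod_product_right _ _ _
      _ = (∏ u : V, g (u, b)) * ∏ b' ∈ B.erase b, ∏ u : V, g (u, b') :=
          (mul_prod_erase _ _ hb).symm
      _ = A * ∏ b' ∈ B.erase b, (algebraMap K E (b - b') * M) := by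
        congr 1
        · rw [← (Equiv.subLeft v).prod_comp]
          refine prod_congr rfl fun u _ => ?_
          simp only [g, hψsub, Equiv.subLeft_apply, Prod.mk.injEq, and_true, sub_self, zero_smul,
            add_zero, sub_eq_self, sub_sub_cancel]
        · refine prod_congr rfl fun b' hb' => ?_
          have hne := ne_of_mem_erase hb'
          rw [← hscale _ (sub_ne_zero.2 hne.symm), ← (Equiv.subLeft v).prod_comp]
          refine prod_congr rfl fun u _ => ?_
          simp only [g, hψsub, Equiv.subLeft_apply, Prod.mk.injEq, hne, and_false, if_false,
            sub_sub_cancel]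
      _ = _ := by
        rw [prod_mul_distrib, prod_const, card_erase_of_mem hb, map_prod]
        ring

theorem nodal_dvd_X_pow_card_sub_one_sub_one {E : Type*} [Field E] [Fintype E] {W : Finset E}
    (hW : (0 : E) ∉ W) : Lagrange.nodal W id ∣ X ^ (Fintype.card E - 1) - 1 := by
  refine Finset.prod_dvd_of_coprime (fun x _ y _ h => ?_) fun x hx => ?_
  · exact pairwise_coprime_X_sub_C Function.injective_id h
  · rw [dvd_iff_isRoot, IsRoot.def, id]
    simp only [eval_sub, eval_pow, eval_X, eval_one]
    rw [FiniteField.pow_card_sub_one_eq_one x (fun h => hW (h ▸ hx)), sub_self]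

/-- The evaluation points are the `x : F` whose norm to `E`, that is
`x ^ (1 + |E| + ⋯ + |E| ^ (m - 1))`, lies in the set given by `exists_translates`. -/
theorem exists_isMDSSelfDual_of_tower {K E F : Type*} [Field K] [Fintype K] [Field E] [Fintype E]
    [Field F] [Fintype F] [Algebra K E] [Algebra E F] {t e m n : ℕ} (hK : Odd (Fintype.card K))
    (ht : Odd t) (hdvd : t ∣ Fintype.card K - 1) (he : e < Module.finrank K E) (hm : Odd m)
    (hF : Fintype.card F = Fintype.card E ^ m) (hsq : IsSquare (-(t : F)))
    (hn : n = (t + 1) * Fintype.card K ^ e * ∑ i ∈ range m, Fintype.card E ^ i) :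
    ∃ C : Submodule F (Fin n → F), IsMDSSelfDual C := by
  classical
  subst hn
  have htpos : 0 < t := ht.pos
  obtain ⟨B, hBcard, hB⟩ := exists_card_eq_prod_sub_eq htpos hdvd
  have hBlt : #B < Fintype.card K := by
    rw [hBcard]
    have h1 : 1 < Fintype.card K := Fintype.one_lt_card
    obtain ⟨c, hc⟩ := hdvd
    obtain ⟨a, ha⟩ := hK
    rcases Nat.even_or_odd' c with ⟨d, rfl | rfl⟩
    · have : 0 < d := by
        rcases Nat.eq_zero_or_pos d with rfl | h
        · simp at hc; omega
        · exact h
      nlinarith [Nat.sub_add_cancel h1.le]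
    · have : Odd (t * (2 * d + 1)) := ht.mul ⟨d, rfl⟩
      rw [← hc, ha, Nat.add_sub_cancel] at this
      exact absurd this (by simp)
  obtain ⟨W, hWcard, hW0, D, hD, hW⟩ := exists_translates (E := E) B hBlt he
  set N := ∑ i ∈ range m, Fintype.card E ^ i with hN
  have hEodd : Odd (Fintype.card E) := by
    rw [Module.card_eq_pow_finrank (K := K) (V := E)]
    exact hK.pow
  have hNodd : Odd N := by
    rw [hN, Finset.odd_sum_iff_odd_card_odd]
    simpa [hEodd.pow] using hm
  have hNmul : N * (Fintype.card E - 1) = Fintype.card F - 1 := by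
    rw [hF, hN]
    exact geom_sum_mul_of_one_le Fintype.card_pos m
  have hNcast : (N : F) = 1 := by
    have h0 : (Fintype.card E : F) = 0 := by
      rw [← map_natCast (algebraMap E F), FiniteField.cast_card_eq_zero, map_zero]
    obtain ⟨l, rfl⟩ := Nat.exists_eq_succ_of_ne_zero hm.pos.ne'
    rw [hN, sum_range_succ']
    simp [h0]
  set G : F[X] := (Lagrange.nodal W id).map (algebraMap E F) with hG
  have hGmonic : G.Monic := (Lagrange.nodal_monic).map _
  have hfmonic : (expand F N G).Monic := hGmonic.expand hNodd.pos
  obtain ⟨S, hS⟩ := exists_nodal_eq_of_dvd hfmonic (by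
    have h1 := map_dvd (expand F N)
      (Polynomial.map_dvd (algebraMap E F) (nodal_dvd_X_pow_card_sub_one_sub_one hW0))
    rw [← hG] at h1
    refine h1.trans ?_
    simp only [Polynomial.map_sub, Polynomial.map_pow, map_X, Polynomial.map_one, map_sub, map_pow,
      expand_X, map_one]
    rw [← pow_mul, hNmul]
    refine ⟨X, ?_⟩
    rw [sub_mul, ← pow_succ, one_mul, Nat.sub_add_cancel Fintype.card_pos])
  have hScard : #S = (t + 1) * Fintype.card K ^ e * N := by
    rw [← Lagrange.natDegree_nodal (s := S) (v := (id : F → F)), hS, natDegree_expand, hG,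
      natDegree_map, Lagrange.natDegree_nodal, hWcard, hBcard]
  refine exists_isMDSSelfDual_of_isSquare_s7 S hScard ?_ ?_
    (μ := -algebraMap E F D) (by simpa using hD) ?_
  · exact ((ht.add_odd odd_one).mul_right _).mul_right _
  · have := hNodd.pos
    have := Fintype.card_pos (α := K)
    positivity
  · intro x hx
    have hroot : eval x (expand F N G) = 0 := by
      rw [← hS]
      exact Lagrange.eval_nodal_at_node (v := id) hx
    rw [expand_eval, hG, eval_map, Lagrange.nodal, eval₂_finsetProd, prod_eq_zero_iff] at hroot
    obtain ⟨w, hw, hxw⟩ := hroot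
    simp only [id, eval₂_sub, eval₂_X, eval₂_C, sub_eq_zero] at hxw
    obtain ⟨b, hb, hprod⟩ := hW w hw
    obtain ⟨l, hl⟩ := hNodd
    have hder : ∏ y ∈ S.erase x, (x - y) =
        algebraMap E F D * algebraMap E F (algebraMap K E (∏ b' ∈ B.erase b, (b - b'))) *
          (x ^ l * x ^ l) := by
      rw [← eval_derivative_nodal_id hx, hS, derivative_expand, eval_mul, expand_eval, hxw, hG,
        derivative_map, eval_map_apply, eval_derivative_nodal_id hw, hprod, map_mul]
      simp only [eval_mul, eval_natCast, eval_pow, eval_X, hNcast, one_mul]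
      rw [hl, Nat.add_sub_cancel, two_mul, pow_add]
    rw [hder]
    rcases hB b hb with h | h
    · rw [h]
      refine ⟨algebraMap E F D * x ^ l, ?_⟩
      simp only [map_neg, map_one]
      ring
    · obtain ⟨y, hy⟩ := hsq
      rw [h]
      refine ⟨algebraMap E F D * x ^ l * y, ?_⟩
      simp only [map_natCast]
      linear_combination (algebraMap E F D * x ^ l) ^ 2 * hy

end Points

theorem stmt_7 (r s m e t p k : ℕ) (hp : p.Prime) (hpodd : Odd p) (hr : r = p ^ k)
    (hk : 0 < k) (hs : 0 < s) (hm : Odd m) (hm0 : 0 < m)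
    (ht : Odd t) (hdvd : t ∣ r - 1) (he : e ≤ s - 1)
    (F : Type*) [Field F] [Fintype F] (hF : Fintype.card F = r ^ (s * m))
    (hchi : quadChar F (-((t : ℕ) : F)) = 1) :
    ∃ C : Submodule F (Fin ((t + 1) * r ^ e * ∑ i ∈ Finset.range m, r ^ (s * i)) → F),
      IsMDSSelfDual C := by
  have := Fact.mk hp
  have hF' : Nat.card F = p ^ (k * s * m) := by
    rw [Nat.card_eq_fintype_card, hF, hr, ← pow_mul, mul_assoc]
  have : CharP F p := charP_of_card_eq_prime_pow (Nat.card_eq_fintype_card (α := F) ▸ hF')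
  let _ : Algebra (ZMod p) F := ZMod.algebra F p
  have hks : k * s ≠ 0 := (Nat.mul_pos hk hs).ne'
  have hfinF : Module.finrank (ZMod p) F = k * s * m :=
    Nat.pow_right_injective hp.two_le ((FiniteField.pow_finrank_eq_natCard p F).trans hF')
  obtain ⟨f⟩ := FiniteField.nonempty_algHom_of_finrank_dvd
    (F := ZMod p) (K := GaloisField p k) (L := GaloisField p (k * s)) (by
      rw [GaloisField.finrank p hk.ne', GaloisField.finrank p hks]
      exact dvd_mul_right _ _)
  obtain ⟨g⟩ := FiniteField.nonempty_algHom_of_finrank_dvd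
    (F := ZMod p) (K := GaloisField p (k * s)) (L := F) (by
      rw [GaloisField.finrank p hks, hfinF]
      exact dvd_mul_right _ _)
  let _ := f.toRingHom.toAlgebra
  let _ := g.toRingHom.toAlgebra
  let _ := Fintype.ofFinite (GaloisField p k)
  let _ := Fintype.ofFinite (GaloisField p (k * s))
  have hK : Fintype.card (GaloisField p k) = r := by
    rw [← Nat.card_eq_fintype_card, GaloisField.card p k hk.ne', hr]
  have hE : Fintype.card (GaloisField p (k * s)) = r ^ s := by
    rw [← Nat.card_eq_fintype_card, GaloisField.card p _ hks, hr, pow_mul]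
  have hr1 : 1 < r := hK ▸ Fintype.one_lt_card
  have hfin : Module.finrank (GaloisField p k) (GaloisField p (k * s)) = s := by
    have := Module.card_eq_pow_finrank (K := GaloisField p k) (V := GaloisField p (k * s))
    rw [hK, hE] at this
    exact (Nat.pow_right_injective hr1 this).symm
  have hsq : IsSquare (-(t : F)) := by
    by_contra h
    rw [quadChar, if_neg h] at hchi
    split_ifs at hchi <;> omega
  refine exists_isMDSSelfDual_of_tower (K := GaloisField p k) (E := GaloisField p (k * s))
    (t := t) (e := e) (m := m) ?_ ht ?_ ?_ hm ?_ hsq ?_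
  · rw [hK, hr]
    exact hpodd.pow
  · rwa [hK]
  · omega
  · rw [hF, hE, pow_mul]
  · simp only [hK, hE, ← pow_mul]
end
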